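/- arXiv:2301.04635 — 2 statements merged into one kernel-verified Lean document; each statement's English description precedes it below -/
import Mathlib

section
/- For any odd integer n ≥ 3, the multiplicative subgroup C_n of the nonzero complex numbers generated by the elements (1 − ω_n^{rs})/(1 − ω_n^r), for all integers 0 < r < n and s ≥ 1 coprime with n, has rank equal to φ(n)/2 − 1, where φ is Euler's totient function. -/
open TensorProduct

/-- The primitive `n`-th root of unity `exp(2πi/n)`. -/
noncomputable def omega (n : ℕ) : ℂ := Complex.exp (2 * Real.pi * Complex.I / n)

/-- The multiplicative subgroup `C_n` of `ℂ*` generated by the cyclotomic units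
`(1 - ω_n^{rs})/(1 - ω_n^r)` for `0 < r < n` and `s ≥ 1` coprime with `n`. -/
noncomputable def Cgrp (n : ℕ) : Subgroup ℂˣ :=
  Subgroup.closure {u : ℂˣ | ∃ r s : ℕ, 0 < r ∧ r < n ∧ 1 ≤ s ∧ s.Coprime n ∧
    (u : ℂ) = (1 - omega n ^ (r * s)) / (1 - omega n ^ r)}

/-- The rank of an abelian group: the dimension of `G ⊗_ℤ ℚ` over `ℚ`. -/
noncomputable def groupRank (H : Type*) [CommGroup H] : Cardinal :=
  Module.rank ℚ (ℚ ⊗[ℤ] Additive H)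

section Analytic
open Filter Topology

lemma abelParts (c : ℕ → ℂ) (v : ℕ → ℂ) (N : ℕ) :
    ∑ k ∈ Finset.range N, c k * v k = (∑ k ∈ Finset.range N, c k) * v N +
      ∑ k ∈ Finset.range N, (∑ j ∈ Finset.range (k+1), c j) * (v k - v (k+1)) := by
  induction N with
  | zero => simp
  | succ N ih =>
    rw [Finset.sum_range_succ, ih, Finset.sum_range_succ (fun k => (∑ j ∈ Finset.range (k+1), c j) * (v k - v (k+1))),
      Finset.sum_range_succ c N]
    ring

lemma weight_bound (k : ℕ) (s : ℝ) (h1 : 1 ≤ s) (h2 : s ≤ 2) :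
    ‖(((((k:ℝ)+1) ^ (-s) : ℝ) : ℂ) - ((((k:ℝ)+1+1) ^ (-s) : ℝ) : ℂ))‖ ≤ 2 / ((k:ℝ)+1)^2 := by
  have hk : (0:ℝ) ≤ k := k.cast_nonneg
  rw [← Complex.ofReal_sub, Complex.norm_real, Real.norm_eq_abs, abs_of_nonneg]
  · have e : ((k:ℝ)+1+1) ^ (-s) = ((k:ℝ)+1)^(-s) * (((k:ℝ)+1)/((k:ℝ)+1+1))^s := by
      rw [Real.div_rpow (by positivity) (by positivity), Real.rpow_neg (by positivity), Real.rpow_neg (by positivity)]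
      have := Real.rpow_pos_of_pos (show (0:ℝ) < k+1 by positivity) s
      field_simp
    have b1 : (((k:ℝ)+1)/((k:ℝ)+1+1))^(2:ℝ) ≤ (((k:ℝ)+1)/((k:ℝ)+1+1))^s := by
      apply Real.rpow_le_rpow_of_exponent_ge (by positivity) _ h2
      rw [div_le_one (by positivity)]; linarith
    have b2 : ((k:ℝ)+1)^(-s) ≤ ((k:ℝ)+1)^(-1:ℝ) :=
      Real.rpow_le_rpow_of_exponent_le (by linarith) (by linarith)
    rw [Real.rpow_neg_one] at b2
    rw [Real.rpow_two] at b1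
    have b3 : 1 - (((k:ℝ)+1)/((k:ℝ)+1+1))^2 ≤ 2 / ((k:ℝ)+1) := by
      rw [div_pow, sub_le_iff_le_add, div_add_div _ _ (by positivity) (by positivity), le_div_iff₀ (by positivity)]
      ring_nf
      nlinarith [pow_nonneg hk 2, pow_nonneg hk 3]
    have p0 : 0 ≤ 1 - (((k:ℝ)+1)/((k:ℝ)+1+1))^2 := by
      rw [sub_nonneg]
      apply pow_le_one₀ (by positivity)
      rw [div_le_one (by positivity)]; linarith
    have p1 : 0 ≤ ((k:ℝ)+1)^(-s) := by positivity
    rw [e]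
    calc _ = ((k:ℝ)+1)^(-s) * (1 - (((k:ℝ)+1)/((k:ℝ)+1+1))^s) := by ring
      _ ≤ ((k:ℝ)+1)^(-s) * (1 - (((k:ℝ)+1)/((k:ℝ)+1+1))^2) := by gcongr
      _ ≤ ((k:ℝ)+1)⁻¹ * (2 / ((k:ℝ)+1)) := by gcongr
      _ = _ := by field_simp
  · rw [sub_nonneg]
    exact Real.rpow_le_rpow_of_nonpos (by positivity) (by linarith) (by linarith)

lemma summable_bd (M : ℝ) : Summable (fun k : ℕ => M * (2 / ((k:ℝ)+1)^2)) := by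
  apply Summable.mul_left
  have := (summable_nat_add_iff 1).2 (Real.summable_one_div_nat_pow.2 (one_lt_two))
  have := this.mul_left 2
  refine this.congr fun k => ?_
  push_cast; ring

lemma partial_tendsto (c : ℕ → ℂ) (M : ℝ) (hM : ∀ N, ‖∑ k ∈ Finset.range N, c k‖ ≤ M)
    (s : ℝ) (h1 : 1 ≤ s) (h2 : s ≤ 2) :
    Tendsto (fun N => ∑ k ∈ Finset.range N, c k * ((((k:ℝ)+1) ^ (-s) : ℝ) : ℂ)) atTop
      (𝓝 (∑' k : ℕ, (∑ j ∈ Finset.range (k+1), c j) * (((((k:ℝ)+1) ^ (-s) : ℝ) : ℂ) - ((((k:ℝ)+1+1) ^ (-s) : ℝ) : ℂ)))) := by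
  have key := fun N => abelParts c (fun k => ((((k:ℝ)+1) ^ (-s) : ℝ) : ℂ)) N
  simp only [Nat.cast_add, Nat.cast_one] at key
  simp_rw [key]
  rw [← zero_add (∑' k : ℕ, _)]
  apply Tendsto.add
  · apply squeeze_zero_norm (a := fun N : ℕ => M * ((N:ℝ)+1)^(-s))
    · intro N
      rw [norm_mul, Complex.norm_real, Real.norm_eq_abs, abs_of_nonneg (by positivity)]
      gcongr
      exact hM N
    · rw [← mul_zero M]
      apply Tendsto.const_mul
      exact (tendsto_rpow_neg_atTop (by linarith)).comp
        (tendsto_atTop_add_const_right _ _ tendsto_natCast_atTop_atTop)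
  · apply HasSum.tendsto_sum_nat
    apply Summable.hasSum
    apply Summable.of_norm_bounded (summable_bd M)
    intro k
    rw [norm_mul]
    gcongr
    · exact (norm_nonneg _).trans (hM 0)
    · exact hM _
    · exact weight_bound k s h1 h2

lemma abel_cont (c : ℕ → ℂ) (M : ℝ) (hM : ∀ N, ‖∑ k ∈ Finset.range N, c k‖ ≤ M) :
    Tendsto (fun s : ℝ => (∑' k : ℕ, (∑ j ∈ Finset.range (k+1), c j) * (((((k:ℝ)+1) ^ (-s) : ℝ) : ℂ) - ((((k:ℝ)+1+1) ^ (-s) : ℝ) : ℂ)))) (𝓝[>] 1)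
     (𝓝 ((∑' k : ℕ, (∑ j ∈ Finset.range (k+1), c j) * (((((k:ℝ)+1) ^ (-1:ℝ) : ℝ) : ℂ) - ((((k:ℝ)+1+1) ^ (-1:ℝ) : ℝ) : ℂ))))) := by
  apply tendsto_tsum_of_dominated_convergence (summable_bd M)
  · intro k
    apply Tendsto.mono_left _ nhdsWithin_le_nhds
    apply ContinuousAt.tendsto (f := fun s : ℝ => (∑ j ∈ Finset.range (k+1), c j) * (((((k:ℝ)+1) ^ (-s) : ℝ) : ℂ) - ((((k:ℝ)+1+1) ^ (-s) : ℝ) : ℂ)))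
    have h1 : (k:ℝ)+1 ≠ 0 := by positivity
    have h2 : (k:ℝ)+1+1 ≠ 0 := by positivity
    have a1 : ContinuousAt (fun s : ℝ => (((k:ℝ)+1) ^ (-s) : ℝ)) 1 :=
      ContinuousAt.rpow continuousAt_const continuousAt_neg (Or.inl h1)
    have a2 : ContinuousAt (fun s : ℝ => (((k:ℝ)+1+1) ^ (-s) : ℝ)) 1 :=
      ContinuousAt.rpow continuousAt_const continuousAt_neg (Or.inl h2)
    exact continuousAt_const.mul ((Complex.continuous_ofReal.continuousAt.comp a1).sub (Complex.continuous_ofReal.continuousAt.comp a2))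
  · have : Set.Ioo (1:ℝ) 2 ∈ 𝓝[>] (1:ℝ) := Ioo_mem_nhdsGT (by norm_num)
    filter_upwards [this] with s hs k
    rw [norm_mul]
    gcongr
    · exact (norm_nonneg _).trans (hM 0)
    · exact hM _
    · exact weight_bound k s hs.1.le hs.2.le

lemma char_bdd {N : ℕ} [NeZero N] (χ : DirichletCharacter ℂ N) (hχ : χ ≠ 1) :
    ∃ M : ℝ, ∀ m, ‖∑ k ∈ Finset.range m, χ (((k+1 : ℕ)) : ZMod N)‖ ≤ M := by
  set A : ℕ → ℂ := fun m => ∑ k ∈ Finset.range m, χ (((k+1 : ℕ)) : ZMod N) with hA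
  have hper : Function.Periodic A N := by
    intro m
    induction m with
    | zero =>
      simp only [hA, zero_add, Finset.range_zero, Finset.sum_empty]
      have h0 := MulChar.sum_eq_zero_of_ne_one hχ
      rw [← Equiv.sum_comp (Equiv.addRight (1 : ZMod N))] at h0
      rw [← h0, Finset.sum_range]
      refine Fintype.sum_equiv (ZMod.finEquiv N).toEquiv _ _ fun i => ?_
      obtain ⟨n, rfl⟩ := Nat.exists_eq_succ_of_ne_zero (NeZero.ne N)
      simp only [Nat.cast_add, Nat.cast_one, ZMod.finEquiv, Equiv.coe_addRight]
      congr 2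
      exact ZMod.natCast_zmod_val (n := n + 1) i
    | succ m ih =>
      have e : m + 1 + N = (m + N) + 1 := by ring
      rw [e]
      simp only [hA] at ih ⊢
      rw [Finset.sum_range_succ, ih, Finset.sum_range_succ]
      congr 2
      push_cast; simp
  refine ⟨∑ r ∈ Finset.range N, ‖A r‖, fun m => ?_⟩
  change ‖A m‖ ≤ _
  rw [← hper.map_mod_nat m]
  exact Finset.single_le_sum (f := fun r => ‖A r‖) (fun _ _ => norm_nonneg _)
    (Finset.mem_range.2 (Nat.mod_lt _ (NeZero.pos N)))

lemma LFunction_one_partial {N : ℕ} [NeZero N] (χ : DirichletCharacter ℂ N) (hχ : χ ≠ 1) :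
    Tendsto (fun n => ∑ i ∈ Finset.range n, χ (i : ZMod N) / (i:ℂ)) atTop
      (𝓝 (χ.LFunction 1)) := by
  obtain ⟨M, hM⟩ := char_bdd χ hχ
  have h1 := partial_tendsto _ M hM 1 le_rfl one_le_two
  have h2 := abel_cont _ M hM
  have h3 : Tendsto (fun s : ℝ => χ.LFunction s) (𝓝[>] 1) (𝓝 (χ.LFunction 1)) := by
    apply Tendsto.mono_left _ nhdsWithin_le_nhds
    have := (DirichletCharacter.differentiable_LFunction hχ).continuous.comp Complex.continuous_ofReal
    have h := this.tendsto 1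
    rw [Function.comp_apply, Complex.ofReal_one] at h
    exact h
  have h4 : (fun s : ℝ => (∑' k : ℕ, (∑ j ∈ Finset.range (k+1), χ ((j+1 : ℕ) : ZMod N)) * (((((k:ℝ)+1) ^ (-s) : ℝ) : ℂ) - ((((k:ℝ)+1+1) ^ (-s) : ℝ) : ℂ))))
      =ᶠ[𝓝[>] 1] (fun s : ℝ => χ.LFunction s) := by
    have : Set.Ioo (1:ℝ) 2 ∈ 𝓝[>] (1:ℝ) := Ioo_mem_nhdsGT (by norm_num)
    filter_upwards [this] with s hs
    refine tendsto_nhds_unique (partial_tendsto _ M hM s hs.1.le hs.2.le) ?_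
    have hre : 1 < (s:ℂ).re := by simpa using hs.1
    rw [DirichletCharacter.LFunction_eq_LSeries χ hre]
    have hs := (ZMod.LSeriesSummable_of_one_lt_re χ hre).LSeriesHasSum
    have := (hasSum_nat_add_iff' 1).2 hs
    simp only [Finset.sum_range_one, LSeries.term_zero, sub_zero] at this
    refine this.tendsto_sum_nat.congr fun n => Finset.sum_congr rfl fun k _ => ?_
    rw [LSeries.term_of_ne_zero (by omega), Complex.ofReal_cpow (by positivity), div_eq_mul_inv, ← Complex.cpow_neg]
    push_cast; rfl
  have h5 := tendsto_nhds_unique (h2.congr' h4) h3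
  rw [h5] at h1
  rw [← tendsto_add_atTop_iff_nat 1]
  refine h1.congr fun n => ?_
  rw [Finset.sum_range_succ']
  simp [Real.rpow_neg_one, div_eq_mul_inv]
lemma gaussSum_ne {N : ℕ} [NeZero N] (χ : DirichletCharacter ℂ N) (hp : χ.IsPrimitive) :
    gaussSum χ (ZMod.stdAddChar (N := N)) ≠ 0 := by
  intro h
  have h1 : ZMod.dft (χ : ZMod N → ℂ) = 0 := by
    ext k
    rw [hp.fourierTransform_eq_inv_mul_gaussSum, h, mul_zero]; rfl
  have h2 : (χ : ZMod N → ℂ) = 0 := (LinearEquiv.map_eq_zero_iff _).1 h1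
  have := congrFun h2 1
  simp at this

lemma sum_log_even {N : ℕ} [NeZero N] (χ : DirichletCharacter ℂ N) (he : χ.Even)
    (x : ℝ) (hx : x ∈ Set.Ioo (0:ℝ) 1) :
    ∑ a : ZMod N, χ a * Complex.log (1 - x * ZMod.stdAddChar a) =
    ∑ a : ZMod N, χ a * (Real.log ‖1 - x * ZMod.stdAddChar a‖ : ℂ) := by
  have key : ∀ a : ZMod N, Complex.log (1 - x * ZMod.stdAddChar (-a)) =
      (starRingEnd ℂ) (Complex.log (1 - x * ZMod.stdAddChar a)) := by
    intro a
    have hn : ‖(x:ℂ) * ZMod.stdAddChar a‖ < 1 := by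
      rw [norm_mul, ZMod.stdAddChar_apply, Circle.norm_coe, mul_one, Complex.norm_real,
        Real.norm_eq_abs, abs_of_pos hx.1]
      exact hx.2
    rw [← Complex.log_conj]
    · congr 1
      rw [map_sub, map_mul, Complex.conj_ofReal, map_one, ZMod.stdAddChar_apply, ZMod.stdAddChar_apply,
        AddChar.map_neg_eq_inv, Circle.coe_inv_eq_conj]
    · have : 0 < (1 - (x:ℂ) * ZMod.stdAddChar a).re := by
        rw [Complex.sub_re, Complex.one_re, sub_pos]
        exact (Complex.re_le_norm _).trans_lt hn
      intro h
      rw [Complex.arg_eq_pi_iff] at h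
      linarith [h.1]
  have h1 : ∑ a : ZMod N, χ a * Complex.log (1 - x * ZMod.stdAddChar a) =
      ∑ a : ZMod N, χ a * (starRingEnd ℂ) (Complex.log (1 - x * ZMod.stdAddChar a)) := by
    rw [← Equiv.sum_comp (Equiv.neg (ZMod N))]
    refine Finset.sum_congr rfl fun a _ => ?_
    rw [Equiv.neg_apply, key, he.eval_neg]
  have h2 : ∀ z : ℂ, (Real.log ‖z‖ : ℂ) = (Complex.log z + (starRingEnd ℂ) (Complex.log z)) / 2 := by
    intro z
    rw [Complex.add_conj, Complex.log_re]
    push_cast; ring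
  simp_rw [h2, mul_div_assoc', mul_add, ← Finset.sum_div, Finset.sum_add_distrib]
  rw [← h1]; ring

lemma sum_log_ne_zero {N : ℕ} [NeZero N] (χ : DirichletCharacter ℂ N) (hp : χ.IsPrimitive)
    (he : χ.Even) (h1 : χ ≠ 1) :
    ∑ a : ZMod N, χ a * (Real.log ‖1 - ZMod.stdAddChar a‖ : ℂ) ≠ 0 := by
  have hN : N ≠ 1 := by
    rintro rfl
    exact h1 (Subsingleton.elim _ _)
  have : Nontrivial (ZMod N) := ZMod.nontrivial_iff.2 hN
  have hinv : χ⁻¹ ≠ 1 := by simpa using h1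
  set τ := gaussSum χ (ZMod.stdAddChar (N := N)) with hτ
  have hL := LFunction_one_partial χ⁻¹ hinv
  have hab := Complex.tendsto_tsum_powerSeries_nhdsWithin_lt hL
  rw [tendsto_map'_iff] at hab
  have hab := hab.const_mul τ
  have heq : (fun x : ℝ => -∑ a : ZMod N, χ a * (Real.log ‖1 - x * ZMod.stdAddChar a‖ : ℂ)) =ᶠ[𝓝[<] 1]
      (fun x : ℝ => τ * ((fun z : ℂ => ∑' n : ℕ, χ⁻¹ (n : ZMod N) / (n:ℂ) * z ^ n) ∘ Complex.ofReal) x) := by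
    filter_upwards [Ioo_mem_nhdsLT (show (0:ℝ) < 1 by norm_num)] with x hx
    rw [← sum_log_even χ he x hx, ← Finset.sum_neg_distrib, Function.comp_apply, ← tsum_mul_left]
    symm
    apply HasSum.tsum_eq
    have hs : ∀ a : ZMod N, HasSum (fun k : ℕ => χ a * ((x * ZMod.stdAddChar a) ^ k / k))
        (-(χ a * Complex.log (1 - x * ZMod.stdAddChar a))) := by
      intro a
      rw [← mul_neg]
      apply HasSum.mul_left
      apply Complex.hasSum_taylorSeries_neg_log
      rw [norm_mul, ZMod.stdAddChar_apply, Circle.norm_coe, mul_one, Complex.norm_real,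
        Real.norm_eq_abs, abs_of_pos hx.1]
      exact hx.2
    have hs := hasSum_sum (s := Finset.univ) fun a _ => hs a
    refine hs.congr_fun ?_
    intro k
    have hg := gaussSum_mulShift_of_isPrimitive (ZMod.stdAddChar (N := N)) hp (k : ZMod N)
    rw [gaussSum] at hg
    simp only [AddChar.mulShift_apply] at hg
    calc _ = (χ⁻¹ (k : ZMod N) * τ) * (x ^ k / k) := by ring
      _ = _ := by
        rw [← hg, Finset.sum_mul]
        refine Finset.sum_congr rfl fun a _ => ?_
        rw [mul_pow, ← AddChar.map_nsmul_eq_pow, nsmul_eq_mul]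
        ring
  have hlim : Tendsto (fun x : ℝ => -∑ a : ZMod N, χ a * (Real.log ‖1 - x * ZMod.stdAddChar a‖ : ℂ))
      (𝓝[<] 1) (𝓝 (-∑ a : ZMod N, χ a * (Real.log ‖1 - ZMod.stdAddChar a‖ : ℂ))) := by
    apply Tendsto.mono_left _ nhdsWithin_le_nhds
    apply Tendsto.neg
    apply tendsto_finsetSum
    intro a _
    by_cases ha : a = 0
    · simp [ha, MulChar.map_zero]
    · apply Tendsto.const_mul
      apply (Complex.continuous_ofReal.tendsto _).comp
      have hne : ‖(1:ℂ) - ZMod.stdAddChar a‖ ≠ 0 := by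
        rw [norm_ne_zero_iff, sub_ne_zero]
        intro h
        apply ha
        apply ZMod.injective_stdAddChar
        rw [← h, AddChar.map_zero_eq_one]
      apply (Real.continuousAt_log hne).tendsto.comp
      have : Continuous (fun x : ℝ => ‖(1:ℂ) - x * ZMod.stdAddChar a‖) := by fun_prop
      have := this.tendsto 1
      simpa using this
  have := tendsto_nhds_unique (hlim.congr' heq) hab
  intro h0
  rw [h0, neg_zero] at this
  exact mul_ne_zero (gaussSum_ne χ hp) (DirichletCharacter.LFunction_apply_one_ne_zero hinv) this.symm

end Analytic

section Algebraic
open NumberField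

lemma groupRank_eq (H : Type*) [CommGroup H] : groupRank H = Module.rank ℤ (Additive H) := by
  have h := IsLocalizedModule.lift_rank_eq (nonZeroDivisors ℤ) (TensorProduct.mk ℤ ℚ (Additive H) 1) le_rfl
  rw [Cardinal.lift_id, Cardinal.lift_id] at h
  rw [groupRank, IsLocalization.rank_eq ℚ (nonZeroDivisors ℤ) le_rfl]
  convert h
  exact Subsingleton.elim _ _

lemma stdAddChar_isPrimitiveRoot (n : ℕ) [NeZero n] (a : (ZMod n)ˣ) :
    IsPrimitiveRoot (ZMod.stdAddChar (a : ZMod n)) n := by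
  constructor
  · rw [← AddChar.map_nsmul_eq_pow]; simp
  · intro l hl
    rw [← AddChar.map_nsmul_eq_pow, ← AddChar.map_zero_eq_one (ZMod.stdAddChar (N := n))] at hl
    have := ZMod.injective_stdAddChar hl
    rw [nsmul_eq_mul, Units.mul_left_eq_zero] at this
    exact (ZMod.natCast_eq_zero_iff _ _).1 this

lemma omega_eq (n : ℕ) [NeZero n] : omega n = ZMod.stdAddChar (1 : ZMod n) := by
  have := ZMod.stdAddChar_coe (N := n) 1
  simp only [Int.cast_one, mul_one] at this
  rw [this, omega]

lemma stdAddChar_mul {n f : ℕ} [NeZero n] [NeZero f] (hf : f ∣ n) (x : ZMod n) :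
    ZMod.stdAddChar (((n / f : ℕ) : ZMod n) * x) = ZMod.stdAddChar (ZMod.castHom hf (ZMod f) x) := by
  obtain ⟨k, rfl⟩ := ZMod.intCast_surjective x
  have h1 := ZMod.stdAddChar_coe (N := n) (((n / f : ℕ) : ℤ) * k)
  have h2 := ZMod.stdAddChar_coe (N := f) k
  rw [map_intCast, h2]
  rw [Int.cast_mul, Int.cast_natCast, Int.cast_mul, Int.cast_natCast] at h1
  rw [h1]
  obtain ⟨m, rfl⟩ := hf
  have hf0 : (f:ℂ) ≠ 0 := by exact_mod_cast NeZero.ne f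
  have hm : m ≠ 0 := by rintro rfl; exact NeZero.ne (f * 0) (by simp)
  have hm0 : (m:ℂ) ≠ 0 := by exact_mod_cast hm
  rw [Nat.mul_div_cancel_left _ (NeZero.pos f)]
  congr 1
  push_cast
  field_simp

instance instCyc (n : ℕ) [NeZero n] : IsCyclotomicExtension {n} ℚ (CyclotomicField n ℚ) := by
  have h := CyclotomicField.isCyclotomicExtension n ℚ
  have e : (DivisionRing.toRatAlgebra : Algebra ℚ (CyclotomicField n ℚ)) = CyclotomicField.algebra n ℚ :=
    Subsingleton.elim _ _
  rw [e]
  exact h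

noncomputable def zInt (n : ℕ) [NeZero n] : 𝓞 (CyclotomicField n ℚ) :=
  (IsCyclotomicExtension.zeta_spec n ℚ (CyclotomicField n ℚ)).toInteger

lemma zInt_prim (n : ℕ) [NeZero n] : IsPrimitiveRoot (zInt n) n :=
  (IsCyclotomicExtension.zeta_spec n ℚ (CyclotomicField n ℚ)).toInteger_isPrimitiveRoot

lemma exists_emb (n : ℕ) [NeZero n] (a : (ZMod n)ˣ) :
    ∃ σ : 𝓞 (CyclotomicField n ℚ) →+* ℂ, Function.Injective σ ∧ σ (zInt n) = ZMod.stdAddChar (a : ZMod n) := by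
  have hirr := Polynomial.cyclotomic.irreducible_rat (NeZero.pos n)
  let e := (IsCyclotomicExtension.zeta_spec n ℚ (CyclotomicField n ℚ)).embeddingsEquivPrimitiveRoots ℂ hirr
  let σ := e.symm ⟨_, (mem_primitiveRoots (NeZero.pos n)).2 (stdAddChar_isPrimitiveRoot n a)⟩
  have hσ : e σ = ⟨_, (mem_primitiveRoots (NeZero.pos n)).2 (stdAddChar_isPrimitiveRoot n a)⟩ := e.apply_symm_apply _
  have := congrArg Subtype.val hσ
  rw [IsPrimitiveRoot.embeddingsEquivPrimitiveRoots_apply_coe] at this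
  refine ⟨(σ : CyclotomicField n ℚ →+* ℂ).comp (algebraMap (𝓞 (CyclotomicField n ℚ)) (CyclotomicField n ℚ)), ?_, this⟩
  exact (σ : CyclotomicField n ℚ →+* ℂ).injective.comp RingOfIntegers.coe_injective

noncomputable def emb (n : ℕ) [NeZero n] (a : (ZMod n)ˣ) : 𝓞 (CyclotomicField n ℚ) →+* ℂ :=
  (exists_emb n a).choose
lemma emb_inj (n : ℕ) [NeZero n] (a : (ZMod n)ˣ) : Function.Injective (emb n a) :=
  (exists_emb n a).choose_spec.1
lemma emb_z (n : ℕ) [NeZero n] (a : (ZMod n)ˣ) : emb n a (zInt n) = ZMod.stdAddChar (a : ZMod n) :=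
  (exists_emb n a).choose_spec.2
lemma emb_one (n : ℕ) [NeZero n] : emb n 1 (zInt n) = omega n := by
  rw [emb_z, omega_eq, Units.val_one]

lemma exists_unit (n : ℕ) [NeZero n] (r s : ℕ) (hr : 0 < r) (hs : s.Coprime n) :
    ∃ u : (𝓞 (CyclotomicField n ℚ))ˣ, (u : 𝓞 (CyclotomicField n ℚ)) * (1 - zInt n ^ r) = 1 - zInt n ^ (r * s) := by
  have hp : IsPrimitiveRoot (zInt n ^ r) (n / n.gcd r) := by
    have h := IsPrimitiveRoot.orderOf (zInt n ^ r)
    rwa [orderOf_pow' _ hr.ne', ← (zInt_prim n).eq_orderOf] at h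
  have hs' : s.Coprime (n / n.gcd r) :=
    Nat.Coprime.coprime_dvd_right (Nat.div_dvd_of_dvd (Nat.gcd_dvd_left n r)) hs
  obtain ⟨u, hu⟩ := hp.associated_sub_one_pow_sub_one_of_coprime hs'
  refine ⟨u, ?_⟩
  rw [pow_mul]
  linear_combination -hu

noncomputable def iota (n : ℕ) [NeZero n] : (𝓞 (CyclotomicField n ℚ))ˣ →* ℂˣ :=
  Units.map (emb n 1 : 𝓞 (CyclotomicField n ℚ) →* ℂ)

lemma iota_inj (n : ℕ) [NeZero n] : Function.Injective (iota n) :=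
  Units.map_injective (emb_inj n 1)

lemma gen_ne (n : ℕ) [NeZero n] (r : ℕ) (hr : 0 < r) (hrn : r < n) : 1 - zInt n ^ r ≠ 0 := by
  rw [sub_ne_zero]
  exact ((zInt_prim n).pow_ne_one_of_pos_of_lt hr.ne' hrn).symm

lemma iota_unit (n : ℕ) [NeZero n] (r s : ℕ) (hr : 0 < r) (hrn : r < n)
    (u : (𝓞 (CyclotomicField n ℚ))ˣ)
    (hu : (u : 𝓞 (CyclotomicField n ℚ)) * (1 - zInt n ^ r) = 1 - zInt n ^ (r * s)) :
    (iota n u : ℂ) = (1 - omega n ^ (r * s)) / (1 - omega n ^ r) := by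
  have h := congrArg (emb n 1) hu
  have h0 : emb n 1 (1 - zInt n ^ r) ≠ 0 := by
    rw [Ne, map_eq_zero_iff _ (emb_inj n 1)]
    exact gen_ne n r hr hrn
  simp only [map_mul, map_sub, map_one, map_pow, emb_one] at h h0
  rw [eq_div_iff h0, ← h]
  rfl

noncomputable def Dgrp (n : ℕ) [NeZero n] : Subgroup (𝓞 (CyclotomicField n ℚ))ˣ :=
  (Cgrp n).comap (iota n)

lemma map_D (n : ℕ) [NeZero n] : (Dgrp n).map (iota n) = Cgrp n := by
  apply Subgroup.map_comap_eq_self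
  rw [Cgrp, Subgroup.closure_le]
  rintro v ⟨r, s, hr, hrn, -, hs, hv⟩
  obtain ⟨u, hu⟩ := exists_unit n r s hr hs
  refine ⟨u, Units.ext ?_⟩
  rw [hv, iota_unit n r s hr hrn u hu]

lemma mem_D (n : ℕ) [NeZero n] (r s : ℕ) (hr : 0 < r) (hrn : r < n) (hs1 : 1 ≤ s) (hs : s.Coprime n)
    (u : (𝓞 (CyclotomicField n ℚ))ˣ)
    (hu : (u : 𝓞 (CyclotomicField n ℚ)) * (1 - zInt n ^ r) = 1 - zInt n ^ (r * s)) : u ∈ Dgrp n := by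
  rw [Dgrp, Subgroup.mem_comap]
  exact Subgroup.subset_closure ⟨r, s, hr, hrn, hs1, hs, iota_unit n r s hr hrn u hu⟩

lemma rank_C_eq (n : ℕ) [NeZero n] : groupRank (Cgrp n) = Module.rank ℤ (Additive (Dgrp n)) := by
  rw [← map_D, groupRank_eq]
  exact ((MulEquiv.toAdditive ((Dgrp n).equivMapOfInjective _ (iota_inj n))).toIntLinearEquiv.rank_eq).symm

lemma rankD_le (n : ℕ) [NeZero n] (hn : 3 ≤ n) :
    Module.rank ℤ (Additive (Dgrp n)) ≤ ((Nat.totient n / 2 - 1 : ℕ) : Cardinal) := by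
  have h1 := LinearMap.rank_le_of_injective
    (MonoidHom.toAdditive (Dgrp n).subtype).toIntLinearMap (Dgrp n).subtype_injective
  refine h1.trans ?_
  rw [← Module.finrank_eq_rank, NumberField.Units.finrank_eq, NumberField.Units.rank,
    InfinitePlace.card_eq_nrRealPlaces_add_nrComplexPlaces,
    IsCyclotomicExtension.Rat.nrRealPlaces_eq_zero (n := n) _ hn,
    IsCyclotomicExtension.Rat.nrComplexPlaces_eq_totient_div_two n, zero_add]

noncomputable def Lam (n : ℕ) [NeZero n] : Additive (Dgrp n) →ₗ[ℤ] ((ZMod n)ˣ → ℂ) :=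
  AddMonoidHom.toIntLinearMap
  { toFun := fun u a => (Real.log ‖emb n a ((u.toMul : (𝓞 (CyclotomicField n ℚ))ˣ) : 𝓞 (CyclotomicField n ℚ))‖ : ℂ)
    map_zero' := by ext a; simp
    map_add' := by
      intro u v
      ext a
      have h : ∀ w : (𝓞 (CyclotomicField n ℚ))ˣ, ‖emb n a (w : 𝓞 (CyclotomicField n ℚ))‖ ≠ 0 := by
        intro w
        rw [norm_ne_zero_iff, Ne, map_eq_zero_iff _ (emb_inj n a)]
        exact w.ne_zero
      simp only [toMul_add, Subgroup.coe_mul, Units.val_mul, map_mul, norm_mul, Pi.add_apply]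
      rw [Real.log_mul (h _) (h _), Complex.ofReal_add] }

lemma Lam_apply (n : ℕ) [NeZero n] (u : Dgrp n) (a : (ZMod n)ˣ) :
    Lam n (Additive.ofMul u) a = (Real.log ‖emb n a ((u : (𝓞 (CyclotomicField n ℚ))ˣ) : 𝓞 (CyclotomicField n ℚ))‖ : ℂ) := rfl

lemma span_rank_le (n : ℕ) [NeZero n] :
    ((Module.finrank ℂ (Submodule.span ℂ (Set.range (Lam n))) : ℕ) : Cardinal) ≤ Module.rank ℤ (Additive (Dgrp n)) := by
  obtain ⟨b, hb, hspan, hli⟩ := exists_linearIndependent ℂ (Set.range (Lam n))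
  rw [Module.finrank_eq_rank, ← hspan, rank_span_set hli]
  have hliZ : LinearIndependent ℤ ((↑) : b → ((ZMod n)ˣ → ℂ)) :=
    hli.restrict_scalars (by
      intro x y h
      simpa using h)
  choose g hg using fun x : b => hb x.2
  have : LinearIndependent ℤ g := by
    apply LinearIndependent.of_comp (Lam n)
    convert hliZ using 1
    ext1 x
    exact hg x
  exact this.cardinal_le_rank

lemma exists_D_elem (n : ℕ) [NeZero n] (hn : 3 ≤ n) {f : ℕ} [NeZero f] (hf : f ∣ n) (hf1 : f ≠ 1)
    (t : (ZMod f)ˣ) : ∃ d : Additive (Dgrp n), ∀ a : (ZMod n)ˣ,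
      Lam n d a = (Real.log ‖1 - ZMod.stdAddChar (ZMod.castHom hf (ZMod f) (a : ZMod n) * (t : ZMod f))‖ : ℂ) -
        (Real.log ‖1 - ZMod.stdAddChar (ZMod.castHom hf (ZMod f) (a : ZMod n))‖ : ℂ) := by
  obtain ⟨s, rfl⟩ := ZMod.unitsMap_surjective hf t
  have hsc := ZMod.val_coe_unit_coprime s
  have hs1 : 1 ≤ (s : ZMod n).val := by
    rw [Nat.one_le_iff_ne_zero]
    intro h
    rw [h, Nat.coprime_zero_left] at hsc
    omega
  have hr : 0 < n / f := Nat.div_pos (Nat.le_of_dvd (NeZero.pos n) hf) (NeZero.pos f)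
  have hrn : n / f < n := Nat.div_lt_self (NeZero.pos n) (by have := NeZero.ne f; omega)
  obtain ⟨u, hu⟩ := exists_unit n (n / f) _ hr hsc
  refine ⟨Additive.ofMul ⟨u, mem_D n _ _ hr hrn hs1 hsc u hu⟩, fun a => ?_⟩
  rw [Lam_apply]
  have h := congrArg (emb n a) hu
  have hz : ∀ k : ℕ, emb n a (zInt n) ^ k = ZMod.stdAddChar ((k : ZMod n) * (a : ZMod n)) := by
    intro k
    rw [emb_z, ← AddChar.map_nsmul_eq_pow, nsmul_eq_mul]
  have h0 : ∀ w : 𝓞 (CyclotomicField n ℚ), w ≠ 0 → ‖emb n a w‖ ≠ 0 := by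
    intro w hw
    rwa [norm_ne_zero_iff, Ne, map_eq_zero_iff _ (emb_inj n a)]
  have hA := h0 _ u.ne_zero
  have hB := h0 _ (gen_ne n _ hr hrn)
  have hlog := congrArg (fun z : ℂ => Real.log ‖z‖) h
  simp only [map_mul, norm_mul] at hlog
  rw [Real.log_mul hA hB] at hlog
  simp only [map_sub, map_one, map_pow, hz] at hlog
  rw [stdAddChar_mul hf] at hlog
  have e2 : (((n / f) * (s : ZMod n).val : ℕ) : ZMod n) * (a : ZMod n) = ((n / f : ℕ) : ZMod n) * ((a : ZMod n) * (s : ZMod n)) := by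
    push_cast
    rw [ZMod.natCast_zmod_val]; ring
  rw [e2, stdAddChar_mul hf, map_mul] at hlog
  rw [← Complex.ofReal_sub, Complex.ofReal_inj, eq_sub_iff_add_eq]
  exact hlog

lemma char_mem (n : ℕ) [NeZero n] (hn : 3 ≤ n) (χ : DirichletCharacter ℂ n) (he : χ.Even) (h1 : χ ≠ 1) :
    (fun a : (ZMod n)ˣ => χ⁻¹ (a : ZMod n)) ∈ Submodule.span ℂ (Set.range (Lam n)) := by
  have hf := χ.conductor_dvd_level
  have : NeZero χ.conductor := ⟨fun h => NeZero.ne n (Nat.eq_zero_of_zero_dvd (h ▸ hf))⟩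
  set χ0 := χ.primitiveCharacter with hχ0
  have hval : ∀ a : (ZMod n)ˣ, χ0 (ZMod.castHom hf (ZMod χ.conductor) (a : ZMod n)) = χ (a : ZMod n) := by
    intro a
    have := DirichletCharacter.changeLevel_eq_cast_of_dvd χ0 hf a
    rw [hχ0, χ.changeLevel_primitiveCharacter] at this
    rw [this]; rfl
  have hp : χ0.IsPrimitive := χ.primitiveCharacter_isPrimitive
  have he0 : χ0.Even := by
    have := hval (-1)
    simp only [Units.val_neg, Units.val_one, map_neg, map_one] at this
    exact this.trans he
  have h10 : χ0 ≠ 1 := by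
    intro h
    apply h1
    rw [← χ.changeLevel_primitiveCharacter, ← hχ0, h, map_one]
  have hf1 : χ.conductor ≠ 1 := by
    intro h
    exact h1 (χ.eq_one_iff_conductor_eq_one.2 h)
  set c := ∑ a : ZMod χ.conductor, χ0 a * (Real.log ‖1 - ZMod.stdAddChar a‖ : ℂ) with hc
  have hc0 : c ≠ 0 := sum_log_ne_zero χ0 hp he0 h10
  have hex : ∀ t : ZMod χ.conductor, ∃ d : Additive (Dgrp n), ∀ a : (ZMod n)ˣ,
      χ0 t * Lam n d a = χ0 t * ((Real.log ‖1 - ZMod.stdAddChar (ZMod.castHom hf (ZMod χ.conductor) (a : ZMod n) * t)‖ : ℂ) -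
        (Real.log ‖1 - ZMod.stdAddChar (ZMod.castHom hf (ZMod χ.conductor) (a : ZMod n))‖ : ℂ)) := by
    intro t
    by_cases ht : IsUnit t
    · obtain ⟨t, rfl⟩ := ht
      obtain ⟨d, hd⟩ := exists_D_elem n hn hf hf1 t
      exact ⟨d, fun a => by rw [hd]⟩
    · exact ⟨0, fun a => by rw [MulChar.map_nonunit _ ht]; simp⟩
  choose d hd using hex
  have hmain : (fun a : (ZMod n)ˣ => χ⁻¹ (a : ZMod n)) = c⁻¹ • ∑ t, χ0 t • Lam n (d t) := by
    ext a
    rw [Pi.smul_apply, Finset.sum_apply]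
    simp only [Pi.smul_apply, smul_eq_mul, hd, mul_sub, Finset.sum_sub_distrib]
    rw [← Finset.sum_mul, MulChar.sum_eq_zero_of_ne_one h10, zero_mul, mul_zero, sub_zero, eq_inv_mul_iff_mul_eq₀ hc0]
    set b := ZMod.unitsMap hf a with hb
    have hb' : ZMod.castHom hf (ZMod χ.conductor) (a : ZMod n) = (b : ZMod χ.conductor) := rfl
    have hvb : χ0 b ≠ 0 := (b.isUnit.map χ0).ne_zero
    have : χ⁻¹ (a : ZMod n) = (χ0 b)⁻¹ := by
      rw [MulChar.inv_apply_eq_inv', ← hval a, hb']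
    rw [this, hb', hc, ← Equiv.sum_comp (Units.mulLeft b)]
    rw [Finset.sum_mul]
    refine Finset.sum_congr rfl fun t _ => ?_
    rw [Units.mulLeft_apply, map_mul]
    field_simp
  rw [hmain]
  exact Submodule.smul_mem _ _ (Submodule.sum_mem _ fun t _ => Submodule.smul_mem _ _ (Submodule.subset_span ⟨_, rfl⟩))

lemma card_even (n : ℕ) [NeZero n] (hn : 3 ≤ n) :
    Nat.card {χ : DirichletCharacter ℂ n // χ.Even ∧ χ ≠ 1} = Nat.totient n / 2 - 1 := by
  classical
  have hne : (-1 : ZMod n) ≠ 1 := by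
    have : Fact (2 < n) := ⟨hn⟩
    exact ZMod.neg_one_ne_one
  obtain ⟨ψ, hψ⟩ := DirichletCharacter.exists_apply_ne_one_of_hasEnoughRootsOfUnity ℂ hne
  have hodd : ψ (-1) = -1 := by
    rcases ψ.even_or_odd with h | h
    · exact absurd h hψ
    · exact h
  have e : {χ : DirichletCharacter ℂ n // χ.Even} ≃ {χ : DirichletCharacter ℂ n // ¬ χ.Even} :=
    { toFun := fun χ => ⟨ψ * χ.1, by
        have := χ.2
        rw [DirichletCharacter.Even] at this ⊢
        rw [MulChar.mul_apply, hodd, this]; norm_num⟩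
      invFun := fun χ => ⟨ψ⁻¹ * χ.1, by
        have h2 : χ.1.Odd := χ.1.even_or_odd.resolve_left χ.2
        rw [DirichletCharacter.Odd] at h2
        rw [DirichletCharacter.Even]
        rw [MulChar.mul_apply, MulChar.inv_apply_eq_inv', hodd, h2]; norm_num⟩
      left_inv := fun χ => by simp
      right_inv := fun χ => by simp }
  have h1 : Nat.card (DirichletCharacter ℂ n) = n.totient := DirichletCharacter.card_eq_totient_of_hasEnoughRootsOfUnity ℂ n
  have h2 := Nat.card_congr (Equiv.sumCompl (fun χ : DirichletCharacter ℂ n => χ.Even))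
  rw [Nat.card_sum, ← Nat.card_congr e, h1] at h2
  have h3 : Nat.card {χ : DirichletCharacter ℂ n // χ.Even ∧ χ ≠ 1} + 1 = Nat.card {χ : DirichletCharacter ℂ n // χ.Even} := by
    have hev : (1 : DirichletCharacter ℂ n).Even := MulChar.one_apply (isUnit_one.neg)
    have e1 : {χ : DirichletCharacter ℂ n | χ.Even ∧ χ ≠ 1} = {χ | χ.Even} \ {1} := by ext; simp
    have := Set.ncard_sdiff_singleton_add_one (s := {χ : DirichletCharacter ℂ n | χ.Even}) hev (Set.toFinite _)
    rw [← e1] at this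
    exact this
  omega

lemma le_span (n : ℕ) [NeZero n] (hn : 3 ≤ n) :
    Nat.totient n / 2 - 1 ≤ Module.finrank ℂ (Submodule.span ℂ (Set.range (Lam n))) := by
  rw [← card_even n hn]
  set S := {χ : DirichletCharacter ℂ n // χ.Even ∧ χ ≠ 1}
  have hli : LinearIndependent ℂ (fun χ : S => (fun a : (ZMod n)ˣ => χ.1⁻¹ (a : ZMod n))) := by
    have h := linearIndependent_monoidHom (ZMod n)ˣ ℂ
    refine h.comp (fun χ : S => (χ.1⁻¹ : DirichletCharacter ℂ n).toMonoidHom.comp (Units.coeHom (ZMod n))) ?_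
    intro χ χ' hh
    apply Subtype.ext
    apply inv_injective
    apply MulChar.ext
    intro a
    exact DFunLike.congr_fun hh a
  let g : S → Submodule.span ℂ (Set.range (Lam n)) := fun χ => ⟨_, char_mem n hn χ.1 χ.2.1 χ.2.2⟩
  have hg : LinearIndependent ℂ g := LinearIndependent.of_comp (Submodule.subtype _) hli
  have : Fintype S := Fintype.ofFinite _
  rw [Nat.card_eq_fintype_card]
  exact hg.fintype_card_le_finrank

end Algebraic

/-- The rank of the group of cyclotomic units `C_n` is `φ(n)/2 - 1` for odd `n ≥ 3`. -/
theorem rank_Cn (n : ℕ) (hn : 3 ≤ n) (hodd : Odd n) :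
    groupRank (Cgrp n) = ((Nat.totient n / 2 - 1 : ℕ) : Cardinal) := by
  have : NeZero n := ⟨by omega⟩
  rw [rank_C_eq]
  refine le_antisymm (rankD_le n hn) (le_trans ?_ (span_rank_le n))
  exact_mod_cast le_span n hn
end

section
/- Let m, n, d ≥ 1 be positive integers with m and n coprime. Let λ_m and λ_n be inverting functions for the Radon transform on (ℤ/mℤ)^d and (ℤ/nℤ)^d respectively. Let π_m : ℤ/mnℤ → ℤ/mℤ and π_m^d : (ℤ/mnℤ)^d → (ℤ/mℤ)^d denote the canonical (coordinatewise) reduction maps, and similarly π_n, π_n^d. Suppose ι_m : Hom((ℤ/mnℤ)^d, ℤ/mnℤ) → Hom((ℤ/mℤ)^d, ℤ/mℤ) satisfies ι_m(ψ) ∘ π_m^d = π_m ∘ ψ for all ψ, and analogously for ι_n. Then the function λ_{mn} defined by λ_{mn}(ψ) = λ_m(ι_m(ψ))·λ_n(ι_n(ψ)) is an inverting function for the Radon transform on (ℤ/mnℤ)^d. -/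
noncomputable instance (n d : ℕ) [NeZero n] : Fintype ((Fin d → ZMod n) →+ ZMod n) :=
  Fintype.ofInjective (fun ψ => (ψ : (Fin d → ZMod n) → ZMod n)) DFunLike.coe_injective

/-- The discrete Radon transform of `f : (ℤ/nℤ)^d → ℂ`:
`Rf(ψ, c) = ∑_{x : ψ(x) = c} f(x)`. -/
noncomputable def Radon (n d : ℕ) [NeZero n] (f : (Fin d → ZMod n) → ℂ)
    (ψ : (Fin d → ZMod n) →+ ZMod n) (c : ZMod n) : ℂ :=
  ∑ x ∈ Finset.univ.filter (fun x => ψ x = c), f x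

/-- `lam` is an inverting function for the Radon transform on `(ℤ/nℤ)^d` if
`f(0) = ∑_ψ lam(ψ)·Rf(ψ, 0)` for every `f`. -/
def IsInvertingFunction (n d : ℕ) [NeZero n]
    (lam : ((Fin d → ZMod n) →+ ZMod n) → ℂ) : Prop :=
  ∀ f : (Fin d → ZMod n) → ℂ, f 0 = ∑ ψ, lam ψ * Radon n d f ψ 0

theorem isInvertingFunction_iff_aux (n d : ℕ) [NeZero n]
    (lam : ((Fin d → ZMod n) →+ ZMod n) → ℂ) :
    IsInvertingFunction n d lam ↔
      ∀ x : Fin d → ZMod n, (∑ ψ : (Fin d → ZMod n) →+ ZMod n,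
        lam ψ * (if ψ x = 0 then 1 else 0)) = if x = 0 then 1 else 0 := by
  constructor
  · intro h x
    have := h (fun y => if y = x then 1 else 0)
    simp only [Radon, Finset.sum_filter] at this
    rw [show (if x = 0 then (1 : ℂ) else 0) = if (0 : Fin d → ZMod n) = x then 1 else 0 by
      simp only [eq_comm], this]
    refine Finset.sum_congr rfl fun ψ _ => ?_
    congr 1
    rw [Finset.sum_eq_single x]
    · simp
    · intro b _ hb
      simp [hb]
    · simp
  · intro h f
    simp only [Radon, Finset.sum_filter, Finset.mul_sum]
    rw [Finset.sum_comm]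
    have key : ∀ y : Fin d → ZMod n, (∑ ψ : (Fin d → ZMod n) →+ ZMod n,
        lam ψ * (if ψ y = 0 then f y else 0)) = (if y = 0 then 1 else 0) * f y := by
      intro y
      rw [← h y, Finset.sum_mul]
      refine Finset.sum_congr rfl fun ψ _ => ?_
      split_ifs <;> simp
    simp only [key]
    simp

/-- Inverting functions for the Radon transform multiply along coprime factorizations. -/
theorem isInvertingFunction_mul (m n d : ℕ) [NeZero m] [NeZero n] (hd : 1 ≤ d)
    (hmn : Nat.Coprime m n)
    (lamM : ((Fin d → ZMod m) →+ ZMod m) → ℂ)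
    (lamN : ((Fin d → ZMod n) →+ ZMod n) → ℂ)
    (hM : IsInvertingFunction m d lamM) (hN : IsInvertingFunction n d lamN)
    (ιM : ((Fin d → ZMod (m * n)) →+ ZMod (m * n)) → ((Fin d → ZMod m) →+ ZMod m))
    (ιN : ((Fin d → ZMod (m * n)) →+ ZMod (m * n)) → ((Fin d → ZMod n) →+ ZMod n))
    (hιM : ∀ (ψ : (Fin d → ZMod (m * n)) →+ ZMod (m * n)) (x : Fin d → ZMod (m * n)),
      ιM ψ (fun i => ZMod.castHom (dvd_mul_right m n) (ZMod m) (x i)) =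
        ZMod.castHom (dvd_mul_right m n) (ZMod m) (ψ x))
    (hιN : ∀ (ψ : (Fin d → ZMod (m * n)) →+ ZMod (m * n)) (x : Fin d → ZMod (m * n)),
      ιN ψ (fun i => ZMod.castHom (dvd_mul_left n m) (ZMod n) (x i)) =
        ZMod.castHom (dvd_mul_left n m) (ZMod n) (ψ x)) :
    IsInvertingFunction (m * n) d (fun ψ => lamM (ιM ψ) * lamN (ιN ψ)) := by
  rw [isInvertingFunction_iff_aux] at hM hN ⊢
  have e := ZMod.chineseRemainder hmn
  have e1 : ∀ a, (e a).1 = ZMod.castHom (dvd_mul_right m n) (ZMod m) a := fun a =>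
    congrArg (fun g : ZMod (m * n) →+* ZMod m => g a)
      (Subsingleton.elim ((RingHom.fst _ _).comp e.toRingHom) _)
  have e2 : ∀ a, (e a).2 = ZMod.castHom (dvd_mul_left n m) (ZMod n) a := fun a =>
    congrArg (fun g : ZMod (m * n) →+* ZMod n => g a)
      (Subsingleton.elim ((RingHom.snd _ _).comp e.toRingHom) _)
  simp only [← e1] at hιM
  simp only [← e2] at hιN
  have zero_iff : ∀ a, a = 0 ↔ (e a).1 = 0 ∧ (e a).2 = 0 := fun a => by
    rw [← map_eq_zero_iff e e.injective, Prod.ext_iff]; rfl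
  have bij : Function.Bijective (fun ψ => (ιM ψ, ιN ψ)) := by
    constructor
    · intro ψ φ h
      obtain ⟨h1, h2⟩ := Prod.mk.inj h
      refine DFunLike.ext _ _ fun x => ?_
      apply e.injective
      apply Prod.ext
      · rw [← hιM, ← hιM, h1]
      · rw [← hιN, ← hιN, h2]
    · rintro ⟨α, β⟩
      let ψ : (Fin d → ZMod (m * n)) →+ ZMod (m * n) :=
        { toFun := fun x => e.symm (α (fun i => (e (x i)).1), β (fun i => (e (x i)).2))
          map_zero' := by
            apply e.injective
            have h1 : (fun _ : Fin d => (0 : ZMod m)) = 0 := rfl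
            have h2 : (fun _ : Fin d => (0 : ZMod n)) = 0 := rfl
            simp [h1, h2]
          map_add' := fun x y => by
            have h1 : (fun i => (e ((x + y) i)).1) =
                (fun i => (e (x i)).1) + (fun i => (e (y i)).1) := by ext i; simp
            have h2 : (fun i => (e ((x + y) i)).2) =
                (fun i => (e (x i)).2) + (fun i => (e (y i)).2) := by ext i; simp
            rw [h1, h2, map_add, map_add, ← map_add e.symm]; rfl }
      refine ⟨ψ, Prod.ext ?_ ?_⟩
      · refine DFunLike.ext _ _ fun u => ?_
        have := hιM ψ (fun i => e.symm (u i, 0))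
        simpa [ψ] using this
      · refine DFunLike.ext _ _ fun u => ?_
        have := hιN ψ (fun i => e.symm (0, u i))
        simpa [ψ] using this
  intro x
  have hx : x = 0 ↔ (fun i => (e (x i)).1) = 0 ∧ (fun i => (e (x i)).2) = 0 := by
    simp only [funext_iff, Pi.zero_apply, zero_iff, forall_and]
  have ite_mul_aux : ∀ (p q r : Prop) [Decidable p] [Decidable q] [Decidable r],
      (p ↔ q ∧ r) → (if p then (1 : ℂ) else 0) = (if q then 1 else 0) * (if r then 1 else 0) := by
    intro p q r _ _ _ h
    by_cases hq : q <;> by_cases hr : r <;> simp [h, hq, hr]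
  rw [ite_mul_aux _ _ _ hx, ← hM, ← hN, Finset.sum_mul_sum, ← Finset.sum_product',
    Finset.univ_product_univ]
  refine Fintype.sum_bijective _ bij _ _ fun ψ => ?_
  have hψ : ψ x = 0 ↔ ιM ψ (fun i => (e (x i)).1) = 0 ∧ ιN ψ (fun i => (e (x i)).2) = 0 := by
    rw [hιM, hιN, ← zero_iff]
  rw [ite_mul_aux _ _ _ hψ]
  ring
end
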